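/- For N₀ = diag(-Iₙ, Iₙ), any 2n×2n orthogonal symplectic matrix N with Nᵀ J N = -J, N² = I and N = Nᵀ is conjugate to N₀ by an orthogonal symplectic matrix: there exists P with Pᵀ P = I, Pᵀ J P = J, and P⁻¹ N P = N₀. -/

import Mathlib

open Matrix

/-- A real idempotent matrix of trace `n` fixes the columns of a matrix with `n` orthonormal
columns. -/
theorem exists_orthonormal_columns_of_isIdempotentElem {ι : Type*} [Fintype ι] [DecidableEq ι]
    {n : ℕ} {Q : Matrix ι ι ℝ} (hQ : IsIdempotentElem Q) (htr : Q.trace = n) :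
    ∃ B : Matrix ι (Fin n) ℝ, Bᵀ * B = 1 ∧ Q * B = B := by
  let f : EuclideanSpace ℝ ι →ₗ[ℝ] EuclideanSpace ℝ ι := toEuclideanLin Q
  have hf : IsIdempotentElem f := by
    ext x i
    simp [f, Matrix.toLpLin_apply, hQ.eq]
  have hrank : Module.finrank ℝ f.range = n := by
    have h := LinearMap.IsIdempotentElem.isProj_range f hf |>.trace
    have ht : LinearMap.trace ℝ _ f = Q.trace := by
      simp only [f, toEuclideanLin_eq_toLin_orthonormal, trace_toLin_eq]
    rw [ht, htr] at h
    exact_mod_cast h.symm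
  let b := (stdOrthonormalBasis ℝ f.range).reindex (finCongr hrank)
  refine ⟨of fun i j => (b j : EuclideanSpace ℝ ι) i, ?_, ?_⟩
  · ext i j
    have h := orthonormal_iff_ite.mp b.orthonormal j i
    rw [Submodule.coe_inner, EuclideanSpace.inner_eq_star_dotProduct] at h
    simpa [mul_apply, dotProduct, one_apply, eq_comm] using h
  · ext i j
    have h := (LinearMap.IsIdempotentElem.isProj_range f hf).map_id _ (b j).2
    have h' := congrArg (fun x : EuclideanSpace ℝ ι => x i) h
    simpa [f, Matrix.toLpLin_apply, mulVec, dotProduct, mul_apply] using h'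

theorem stmt_3 (n : ℕ) (J N : Matrix (Fin n ⊕ Fin n) (Fin n ⊕ Fin n) ℝ)
    (hJ : J = Matrix.fromBlocks 0 (-1) 1 0)
    (hNorth : Nᵀ * N = 1) (hNJ : Nᵀ * J * N = -J) (hN2 : N * N = 1) (hNsym : N = Nᵀ) :
    ∃ P : Matrix (Fin n ⊕ Fin n) (Fin n ⊕ Fin n) ℝ,
      Pᵀ * P = 1 ∧ Pᵀ * J * P = J ∧
      P⁻¹ * N * P = Matrix.fromBlocks (-1) 0 0 1 := by
  rw [← hNsym] at hNJ
  have hJT : Jᵀ = -J := by simp [hJ, fromBlocks_transpose, fromBlocks_neg]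
  have hJJ : J * J = -1 := by simp [hJ, fromBlocks_multiply, ← fromBlocks_one, fromBlocks_neg]
  have hanti : N * J = -(J * N) := by
    rw [← neg_mul, ← hNJ, Matrix.mul_assoc, hN2, Matrix.mul_one]
  have htr : N.trace = 0 := by
    have h : (J * (N * J)).trace = N.trace := by
      rw [hanti, Matrix.mul_neg, ← Matrix.mul_assoc, hJJ, neg_one_mul, neg_neg]
    rw [trace_mul_comm, Matrix.mul_assoc, hJJ, Matrix.mul_neg, Matrix.mul_one, trace_neg] at h
    linarith
  have hQ : IsIdempotentElem ((2⁻¹ : ℝ) • (1 - N)) := by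
    rw [IsIdempotentElem, smul_mul_smul_comm, sub_mul, mul_sub, mul_sub, hN2, mul_one, mul_one, one_mul]
    module
  obtain ⟨B, hBB, hQB⟩ := exists_orthonormal_columns_of_isIdempotentElem (n := n) hQ (by
    simp [trace_sub, htr, trace_one]
    ring)
  have hNB : N * B = -B := by
    rw [Matrix.smul_mul, Matrix.sub_mul, Matrix.one_mul] at hQB
    have h : B - N * B = (2 : ℝ) • B := by rw [← hQB, smul_smul]; simp [hQB]
    rw [← sub_sub_cancel B (N * B), h]
    module
  have hBN : Bᵀ * N = -Bᵀ := by
    rw [hNsym, ← transpose_mul, hNB, transpose_neg]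
  have hBJB : Bᵀ * (J * B) = 0 := by
    have h : Bᵀ * (J * B) = -(Bᵀ * (J * B)) := by
      calc Bᵀ * (J * B) = (Bᵀ * N) * J * (N * B) := by
            rw [hBN, hNB]; simp [Matrix.mul_assoc]
        _ = Bᵀ * (N * J * N) * B := by simp only [Matrix.mul_assoc]
        _ = _ := by rw [hNJ]; simp [Matrix.mul_assoc]
    ext i j
    exact self_eq_neg.mp (congrFun₂ h i j)
  have hJJB : J * (J * B) = -B := by rw [← Matrix.mul_assoc, hJJ, Matrix.neg_mul, Matrix.one_mul]
  have hNJB : N * (J * B) = J * B := by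
    rw [← Matrix.mul_assoc, hanti, Matrix.neg_mul, Matrix.mul_assoc, hNB, Matrix.mul_neg, neg_neg]
  let P := fromCols B (J * B)
  have hPP : Pᵀ * P = 1 := by
    simp only [P, transpose_fromCols, fromRows_mul_fromCols, transpose_mul, hJT, Matrix.mul_neg,
      Matrix.neg_mul, Matrix.mul_assoc, hJJB, hBJB, hBB, neg_neg, neg_zero, fromBlocks_one]
  have hJP : J * P = P * J := by
    simp only [P, mul_fromCols, hJJB]
    simp [hJ, fromCols_mul_fromBlocks]
  have hNP : N * P = P * fromBlocks (-1) 0 0 1 := by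
    simp [P, mul_fromCols, hNB, hNJB, fromCols_mul_fromBlocks]
  refine ⟨P, hPP, ?_, ?_⟩
  · rw [Matrix.mul_assoc, hJP, ← Matrix.mul_assoc, hPP, Matrix.one_mul]
  · rw [inv_eq_left_inv hPP, Matrix.mul_assoc, hNP, ← Matrix.mul_assoc, hPP, Matrix.one_mul]
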